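/- For each odd prime p there is no local nearring R of order p⁴ whose additive group R⁺ is generated by elements a, b satisfying p²•a = 0, p²•b = 0, −b − a + b + a = p•b and p•b ≠ 0. (These conditions say exactly that R⁺ is isomorphic to the group G₂ = C_{p²} ⋊ C_{p²} of order p⁴ and nilpotency class 2; hence G₂ is not the additive group of any local nearring.) -/

import Mathlib

/-- A left nearring with identity: `(R,+)` is a (not necessarily abelian) group,
`(R,·)` is a monoid, and the left distributive law holds. -/
class NearringWithOne (R : Type*) extends AddGroup R, Monoid R where
  left_distrib : ∀ x y z : R, x * (y + z) = x * y + x * z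

theorem swap_formula {G : Type*} [AddGroup G] {a b c : G} (h : b + a = a + (b + c))
    (ca : AddCommute c a) (cb : AddCommute c b) (n k : ℤ) :
    n • b + k • a = k • a + n • b + (k * n) • c := by
  have h1 : AddSemiconjBy a (b + c) b := h.symm
  have h2 : a + n • (b + c) = n • b + a := h1.zsmul_right n
  rw [AddCommute.zsmul_add cb.symm] at h2
  have h3 : AddSemiconjBy (n • b) a (a + n • c) := by
    show n • b + a = a + n • c + n • b
    rw [← h2, add_assoc, ((cb.zsmul_left n).zsmul_right n).eq]
  have h4 : n • b + k • a = k • (a + n • c) + n • b := h3.zsmul_right k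
  rw [h4, AddCommute.zsmul_add (ca.symm.zsmul_right n), ← mul_zsmul', add_assoc, add_assoc,
    ((cb.zsmul_left _).zsmul_right n).eq, mul_comm]

theorem key_hom (p : ℕ) (hp : p.Prime) {G : Type} [AddGroup G] [Finite G]
    (hcard : Nat.card G = p ^ 4) (a b : G) (hcl : AddSubgroup.closure {a, b} = ⊤)
    (ha : (p ^ 2) • a = 0) (hb : (p ^ 2) • b = 0) (hab : -b - a + b + a = p • b)
    (hpb : p • b ≠ 0) :
    ∃ (Q : Type) (_ : AddGroup Q) (ψ : G →+ Q), (∃ x, ψ x ≠ 0) ∧ (∀ x, p • ψ x = 0) ∧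
      ∀ φ : G ≃+ G, ∀ x, ψ (φ x) = ψ x := by
  have h : b + a = a + (b + p • b) := by
    rw [← hab]; simp [sub_eq_add_neg, ← add_assoc]
  have cb : AddCommute (p • b) b := (AddCommute.refl b).nsmul_left p
  have ca : AddCommute (p • b) a := by
    have h1 : AddSemiconjBy a (b + p • b) b := h.symm
    have h2 : a + p • (b + p • b) = p • b + a := h1.nsmul_right p
    rw [cb.symm.add_nsmul, ← mul_nsmul', ← pow_two, hb, add_zero] at h2
    exact h2.symm
  have hc : p • b = (p : ℤ) • b := (natCast_zsmul b p).symm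
  have sw := swap_formula h ca cb
  have cbz : ∀ m n : ℤ, AddCommute (m • p • b) (n • b) := fun m n =>
    (cb.zsmul_left m).zsmul_right n
  have caz : ∀ m n : ℤ, AddCommute (m • p • b) (n • a) := fun m n =>
    (ca.zsmul_left m).zsmul_right n
  have rep : ∀ x : G, ∃ k n : ℤ, x = k • a + n • b := by
    intro x
    have hx : x ∈ AddSubgroup.closure {a, b} := by rw [hcl]; trivial
    induction hx using AddSubgroup.closure_induction with
    | mem x hx =>
      rcases hx with rfl | rfl
      · exact ⟨1, 0, by simp⟩
      · exact ⟨0, 1, by simp⟩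
    | zero => exact ⟨0, 0, by simp⟩
    | add x y _ _ hx hy =>
      obtain ⟨k, n, rfl⟩ := hx
      obtain ⟨k', n', rfl⟩ := hy
      refine ⟨k + k', n + (k' * n) * p + n', ?_⟩
      rw [add_assoc, ← add_assoc (n • b), sw, hc, ← mul_zsmul']
      simp only [add_zsmul, add_assoc, mul_comm]
    | neg x _ hx =>
      obtain ⟨k, n, rfl⟩ := hx
      refine ⟨-k, -n + ((-k) * (-n)) * p, ?_⟩
      rw [neg_add_rev, ← neg_zsmul, ← neg_zsmul, sw, hc, ← mul_zsmul']
      simp only [add_zsmul, add_assoc, mul_comm]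
  let B := AddSubgroup.zmultiples b
  have hBn : B.Normal := by
    constructor
    rintro _ ⟨j, rfl⟩ g
    obtain ⟨k, n, rfl⟩ := rep g
    refine ⟨j + (-k * j) * p, ?_⟩
    have : k • a + n • b + j • b + -(k • a + n • b) = k • a + (j • b + (-k) • a) := by
      rw [neg_add_rev, ← neg_zsmul, ← neg_zsmul, add_assoc, add_assoc, ← add_assoc (j • b),
        ← add_zsmul, ← add_assoc (n • b), ← add_zsmul]
      congr 3
      ring
    show (j + (-k * j) * p) • b = k • a + n • b + j • b + -(k • a + n • b)
    rw [this, sw, hc, ← mul_zsmul', add_zsmul, ← add_assoc, ← add_assoc, ← add_zsmul]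
    rw [add_zsmul]
    simp [mul_comm]
  let π : G →+ G ⧸ B := QuotientAddGroup.mk' B
  have πb : π b = 0 := (QuotientAddGroup.eq_zero_iff b).2 (AddSubgroup.mem_zmultiples b)
  have πrep : ∀ k n : ℤ, π (k • a + n • b) = k • π a := by
    intro k n
    simp [map_add, map_zsmul, πb]
  have comm : ∀ x y : G, AddCommute (π x) (π y) := by
    intro x y
    obtain ⟨k, n, rfl⟩ := rep x
    obtain ⟨k', n', rfl⟩ := rep y
    rw [πrep, πrep]
    exact ((AddCommute.refl (π a)).zsmul_left k).zsmul_right k'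
  let ψ : G →+ G ⧸ B := AddMonoidHom.mk' (fun x => p • π x) (by
    intro x y
    show p • π (x + y) = p • π x + p • π y
    rw [map_add, (comm x y).add_nsmul])
  have ψdef : ∀ x, ψ x = p • π x := fun _ => rfl
  have ψrep : ∀ k n : ℤ, ψ (k • a + n • b) = k • ψ a := by
    intro k n
    rw [map_add, map_zsmul, map_zsmul, ψdef b, πb]; simp
  have ψa : ψ a ≠ 0 := by
    intro h0
    have h1 : addOrderOf (π a) ∣ p := addOrderOf_dvd_of_nsmul_eq_zero h0
    have h2 : AddSubgroup.zmultiples (π a) = ⊤ := by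
      rw [eq_top_iff]
      intro q _
      obtain ⟨x, rfl⟩ := QuotientAddGroup.mk'_surjective B q
      obtain ⟨k, n, rfl⟩ := rep x
      exact ⟨k, (πrep k n).symm⟩
    have h3 : Nat.card (G ⧸ B) ∣ p := by
      rw [← Nat.card_zmultiples, h2] at h1
      rwa [AddSubgroup.card_top] at h1
    have h4 : Nat.card B ∣ p ^ 2 := by
      rw [Nat.card_zmultiples]
      exact addOrderOf_dvd_of_nsmul_eq_zero hb
    have h5 := AddSubgroup.card_eq_card_quotient_mul_card_addSubgroup B
    have h6 := mul_dvd_mul h3 h4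
    rw [← h5, hcard, ← pow_succ'] at h6
    have := (Nat.pow_dvd_pow_iff_le_right hp.one_lt).1 h6
    omega
  have ψp : ∀ x, p • ψ x = 0 := by
    intro x
    obtain ⟨k, n, rfl⟩ := rep x
    rw [← map_nsmul, ψdef, map_nsmul, πrep, ← mul_nsmul', ← pow_two, ← natCast_zsmul,
      ← mul_zsmul', mul_comm, mul_zsmul', natCast_zsmul, ← map_nsmul, ha]
    simp
  have ordψ : addOrderOf (ψ a) = p := by
    have := Fact.mk hp
    exact addOrderOf_eq_prime (ψp a) ψa
  have ordc : addOrderOf (p • b) = p := by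
    have := Fact.mk hp
    exact addOrderOf_eq_prime (by rw [← mul_nsmul', ← pow_two, hb]) hpb
  refine ⟨G ⧸ B, inferInstance, ψ, ⟨a, ψa⟩, ψp, ?_⟩
  intro φ
  have eb : ψ (φ b) = 0 := by
    rw [ψdef, ← map_nsmul, ← map_nsmul, ← hab]
    have := (comm (φ b) (φ a)).eq
    simp only [map_add, map_sub, map_neg]
    rw [add_assoc, this]
    simp [sub_eq_add_neg, add_assoc]
  obtain ⟨m, n, hφb⟩ := rep (φ b)
  obtain ⟨k, l, hφa⟩ := rep (φ a)
  have hm : (p : ℤ) ∣ m := by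
    rw [hφb, ψrep] at eb
    rw [← ordψ]
    exact addOrderOf_dvd_iff_zsmul_eq_zero.2 eb
  obtain ⟨m', rfl⟩ := hm
  have pc0 : (p : ℤ) • p • b = 0 := by
    rw [natCast_zsmul, ← mul_nsmul', ← pow_two, hb]
  have cpa : ∀ s : ℤ, AddCommute ((p * m' : ℤ) • a) (s • b) := by
    intro s
    have := sw s (p * m')
    have h0 : ((p : ℤ) * m' * s) • p • b = 0 := by
      rw [show (p : ℤ) * m' * s = (m' * s) * p by ring, mul_zsmul, pc0, zsmul_zero]
    rw [h0, add_zero] at this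
    exact this.symm
  have e1 : φ (p • b) = n • p • b := by
    rw [map_nsmul, hφb, (cpa n).add_nsmul, ← natCast_zsmul, ← mul_zsmul',
      show (p * m' * p : ℤ) = m' * (p ^ 2 : ℕ) by push_cast; ring, mul_zsmul, natCast_zsmul, ha,
      zsmul_zero, zero_add, hc, ← natCast_zsmul, ← mul_zsmul', ← mul_zsmul']
    simp [mul_comm]
  have e2 : φ b + φ a = φ a + φ b + φ (p • b) := by
    rw [← map_add, ← map_add, ← map_add, h, add_assoc]
  have e3 : φ b + φ a = φ a + φ b + (k * n) • p • b := by
    have hz : φ b + φ a = (p * m') • a + (n • b + k • a) + l • b := by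
      rw [hφb, hφa]; simp only [add_assoc]
    have c1 : AddCommute ((p * m' : ℤ) • a) (k • a) :=
      ((AddCommute.refl a).zsmul_left _).zsmul_right _
    rw [hz, sw, hφa, hφb]
    have c2 : n • b + l • b = l • b + n • b := by rw [← add_zsmul, ← add_zsmul, add_comm]
    calc _ = ((p * m' : ℤ) • a + k • a) + n • b + ((k * n) • p • b + l • b) := by
            simp only [add_assoc]
      _ = k • a + (p * m' : ℤ) • a + (n • b + l • b) + (k * n) • p • b := by
            rw [c1.eq, (cbz (k * n) l).eq]; simp only [add_assoc]
      _ = k • a + ((p * m' : ℤ) • a + l • b) + n • b + (k * n) • p • b := by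
            rw [c2]; simp only [add_assoc]
      _ = _ := by rw [(cpa l).eq]; simp only [add_assoc]
  have e4 : n • p • b = (k * n) • p • b := by
    rw [e2, e1] at e3
    exact add_left_cancel e3
  have e5 : (p : ℤ) ∣ (k - 1) * n := by
    rw [← ordc]
    apply addOrderOf_dvd_iff_zsmul_eq_zero.2
    rw [sub_mul, one_mul, sub_zsmul, ← e4]; simp
  have hn : ¬ (p : ℤ) ∣ n := by
    intro hd
    have h0 : n • p • b = 0 := by
      apply addOrderOf_dvd_iff_zsmul_eq_zero.1
      rw [ordc]; exact hd
    rw [h0] at e1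
    exact hpb ((map_eq_zero_iff φ φ.injective).1 e1)
  have hk : (p : ℤ) ∣ k - 1 := by
    rcases (Nat.prime_iff_prime_int.1 hp).dvd_or_dvd e5 with h | h
    · exact h
    · exact absurd h hn
  have ea : ψ (φ a) = ψ a := by
    rw [hφa, ψrep]
    have : (k - 1) • ψ a = 0 := by
      apply addOrderOf_dvd_iff_zsmul_eq_zero.1
      rw [ordψ]; exact hk
    rw [show k = (k - 1) + 1 by ring, add_zsmul, this]; simp
  intro x
  obtain ⟨s, t, rfl⟩ := rep x
  rw [map_add, map_zsmul, map_zsmul, map_add, map_zsmul, map_zsmul, ea, eb, map_add, map_zsmul,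
    map_zsmul, ψdef b, πb]
  simp

/-- For each odd prime `p` there is no local nearring of order `p⁴` whose additive
group is the group `G₂ = C_{p²} ⋊ C_{p²}`. -/
theorem no_local_nearring_G2 (p : ℕ) (hp : p.Prime) (hodd : Odd p) :
    ¬ ∃ (R : Type) (_ : NearringWithOne R) (_ : Fintype R) (L : AddSubgroup R),
        (∀ x : R, x ∈ L ↔ ¬ IsUnit x) ∧
        Fintype.card R = p ^ 4 ∧
        ∃ a b : R,
          AddSubgroup.closure {a, b} = ⊤ ∧
          (p ^ 2) • a = 0 ∧ (p ^ 2) • b = 0 ∧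
          -b - a + b + a = p • b ∧ p • b ≠ 0 := by
  rintro ⟨R, inst, fin, L, hL, hcard, a, b, hcl, ha, hb, hab, hpb⟩
  obtain ⟨Q, _, ψ, ⟨y, hy⟩, ψp, hψ⟩ :=
    key_hom p hp (by rw [Nat.card_eq_fintype_card, hcard]) a b hcl ha hb hab hpb
  have hu : ∀ u : R, IsUnit u → ψ u = ψ 1 := by
    rintro _ ⟨u, rfl⟩
    let φ : R ≃+ R :=
      { toFun := fun x => u * x
        invFun := fun x => (↑u⁻¹ : R) * x
        left_inv := fun x => by simp [← mul_assoc]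
        right_inv := fun x => by simp [← mul_assoc]
        map_add' := fun x y => NearringWithOne.left_distrib _ x y }
    have := hψ φ 1
    simpa [φ] using this
  have h1 : (1 : R) ∉ L := fun h => (hL 1).1 h isUnit_one
  have hm1 : IsUnit (-1 : R) := by
    by_contra h
    exact h1 (neg_mem_iff.1 ((hL (-1)).2 h))
  have e := hu _ hm1
  rw [map_neg] at e
  have e2 : 2 • ψ 1 = 0 := by rw [two_nsmul]; nth_rewrite 1 [← e]; simp
  have ψ1 : ψ 1 = 0 := by
    have d2 := addOrderOf_dvd_of_nsmul_eq_zero e2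
    have dp := addOrderOf_dvd_of_nsmul_eq_zero (ψp 1)
    have := Nat.dvd_gcd d2 dp
    rw [(Nat.coprime_two_left).2 hodd] at this
    exact AddMonoid.addOrderOf_eq_one_iff.1 (Nat.dvd_one.1 this)
  have hyL : y ∈ L := by
    rw [hL]; intro h; exact hy ((hu y h).trans ψ1)
  have hsL : 1 + y ∉ L := fun h => h1 ((add_mem_cancel_right hyL).1 h)
  have hsu : IsUnit (1 + y) := by
    by_contra h; exact hsL ((hL _).2 h)
  have := hu _ hsu
  rw [map_add] at this
  exact hy (by simpa using this)
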